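/- arXiv:2504.09126 — 4 statements merged into one kernel-verified Lean document; each statement's English description precedes it below -/
import Mathlib

section
/- Let C be a quasi-cyclic code of length 2m and index 2 over F, viewed as an R-submodule of R². Then there exist polynomials g11, g12, g22 in F[x] such that C is the R-submodule of R² generated by the two elements (g11(x), g12(x)) and (0, g22(x)), and the following conditions hold: g11 divides x^m − 1, g22 divides x^m − 1, deg g12 < deg g22, and g11·g22 divides (x^m − 1)·g12. Moreover, for any such pair of generators satisfying these conditions, the F-dimension of C equals 2m − deg g11 − deg g22. -/
open Polynomial

noncomputable section

variable {K : Type*} [Field K]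

/-- The code generated by `(a, b)` and `(0, c)` over `K[X] / (P)`. -/
def triangularCode (P a b c : K[X]) :
    Submodule (AdjoinRoot P) (AdjoinRoot P × AdjoinRoot P) :=
  Submodule.span (AdjoinRoot P)
    {(AdjoinRoot.mk P a, AdjoinRoot.mk P b), (0, AdjoinRoot.mk P c)}

lemma mem_triangularCode {P a b c : K[X]} {z : AdjoinRoot P × AdjoinRoot P} :
    z ∈ triangularCode P a b c ↔
      ∃ u v : K[X], (AdjoinRoot.mk P (u * a), AdjoinRoot.mk P (u * b + v * c)) = z := by
  rw [triangularCode, Submodule.mem_span_pair]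
  constructor
  · rintro ⟨r, s, rfl⟩
    obtain ⟨u, rfl⟩ := AdjoinRoot.mk_surjective r
    obtain ⟨v, rfl⟩ := AdjoinRoot.mk_surjective s
    exact ⟨u, v, by simp⟩
  · rintro ⟨u, v, rfl⟩
    exact ⟨AdjoinRoot.mk P u, AdjoinRoot.mk P v, by simp⟩

lemma exists_eq_triangularCode {P : K[X]} (hP : P ≠ 0)
    (C : Submodule (AdjoinRoot P) (AdjoinRoot P × AdjoinRoot P)) :
    ∃ a b c : K[X], C = triangularCode P a b c ∧ a ∣ P ∧ c ∣ P ∧ b.degree < c.degree ∧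
      a * c ∣ P * b := by
  have smul_mem (q r s : K[X]) (h : (AdjoinRoot.mk P r, AdjoinRoot.mk P s) ∈ C) :
      (AdjoinRoot.mk P (q * r), AdjoinRoot.mk P (q * s)) ∈ C := by
    simpa using C.smul_mem (AdjoinRoot.mk P q) h
  let I : Ideal K[X] := Ideal.comap (AdjoinRoot.mk P) (C.map (LinearMap.fst _ _ _))
  let J : Ideal K[X] := Ideal.comap (AdjoinRoot.mk P) (C.comap (LinearMap.inr _ _ _))
  have mem_I (f : K[X]) : f ∈ I ↔ ∃ g : K[X], (AdjoinRoot.mk P f, AdjoinRoot.mk P g) ∈ C := by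
    constructor
    · rintro ⟨⟨r, s⟩, h, rfl : r = _⟩
      obtain ⟨g, rfl⟩ := AdjoinRoot.mk_surjective s
      exact ⟨g, h⟩
    · rintro ⟨g, h⟩
      exact ⟨_, h, rfl⟩
  have mem_J (g : K[X]) : g ∈ J ↔ (0, AdjoinRoot.mk P g) ∈ C := Iff.rfl
  obtain ⟨a, ha⟩ := IsPrincipalIdealRing.principal I
  obtain ⟨c, hc⟩ := IsPrincipalIdealRing.principal J
  have dvd_a (f : K[X]) : f ∈ I ↔ a ∣ f := by rw [ha]; exact Ideal.mem_span_singleton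
  have dvd_c (f : K[X]) : f ∈ J ↔ c ∣ f := by rw [hc]; exact Ideal.mem_span_singleton
  have haP : a ∣ P := (dvd_a P).1 ((mem_I P).2 ⟨0, by simp [← Prod.zero_eq_mk]⟩)
  have hcP : c ∣ P := (dvd_c P).1 ((mem_J P).2 (by simp [← Prod.zero_eq_mk]))
  have hc0 : c ≠ 0 := ne_zero_of_dvd_ne_zero hP hcP
  obtain ⟨b', hb'⟩ := (mem_I a).1 ((dvd_a a).2 dvd_rfl)
  have hcC : (0, AdjoinRoot.mk P c) ∈ C := (mem_J c).1 ((dvd_c c).2 dvd_rfl)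
  have hb : (AdjoinRoot.mk P a, AdjoinRoot.mk P (b' % c)) ∈ C := by
    have h := C.sub_mem hb' (C.smul_mem (AdjoinRoot.mk P (b' / c)) hcC)
    have e : b' % c = b' - b' / c * c := by
      linear_combination EuclideanDomain.mod_add_div b' c
    rw [e]
    simpa using h
  refine ⟨a, b' % c, c, ?_, haP, hcP, EuclideanDomain.mod_lt b' hc0, ?_⟩
  · ext ⟨r, s⟩
    rw [mem_triangularCode]
    obtain ⟨f, rfl⟩ := AdjoinRoot.mk_surjective r
    obtain ⟨g, rfl⟩ := AdjoinRoot.mk_surjective s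
    constructor
    · intro h
      obtain ⟨u, rfl⟩ := (dvd_a f).1 ((mem_I f).2 ⟨g, h⟩)
      have h' : g - u * (b' % c) ∈ J := by
        rw [mem_J]
        have := C.sub_mem h (smul_mem u _ _ hb)
        simpa [mul_comm] using this
      obtain ⟨v, hv⟩ := (dvd_c _).1 h'
      refine ⟨u, v, ?_⟩
      rw [mul_comm u a, mul_comm v c, ← hv]
      simp
    · rintro ⟨u, v, h⟩
      rw [← h]
      have := C.add_mem (smul_mem u _ _ hb) (C.smul_mem (AdjoinRoot.mk P v) hcC)
      simpa using this
  · obtain ⟨d, hd⟩ := haP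
    have h := smul_mem d _ _ hb
    rw [mul_comm d a, ← hd, AdjoinRoot.mk_self, ← mem_J, dvd_c] at h
    have h' := mul_dvd_mul_left a h
    rwa [← mul_assoc, ← hd] at h'

lemma eq_zero_of_dvd_mul {P a u : K[X]} (hP : P ≠ 0) (ha : a ∣ P)
    (hu : u ∈ degreeLT K (P.natDegree - a.natDegree)) (h : P ∣ u * a) : u = 0 := by
  have ha0 : a ≠ 0 := ne_zero_of_dvd_ne_zero hP ha
  by_contra hu0
  have h1 := natDegree_le_of_dvd h (mul_ne_zero hu0 ha0)
  rw [natDegree_mul hu0 ha0] at h1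
  rw [mem_degreeLT, degree_eq_natDegree hu0, Nat.cast_lt] at hu
  omega

lemma mod_mem_degreeLT {P a d : K[X]} (hP : P ≠ 0) (h : P = a * d) (u : K[X]) :
    u % d ∈ degreeLT K (P.natDegree - a.natDegree) := by
  have ha0 : a ≠ 0 := by rintro rfl; simp [hP] at h
  have hd0 : d ≠ 0 := by rintro rfl; simp [hP] at h
  rw [mem_degreeLT, h, natDegree_mul ha0 hd0, Nat.add_sub_cancel_left,
    ← degree_eq_natDegree hd0]
  exact EuclideanDomain.mod_lt u hd0

/-- The encoding map of the code generated by `(a, b)` and `(0, c)` over `K[X] / (P)`. -/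
def triangularEncode (P a b c : K[X]) (S T : Submodule K K[X]) :
    S × T →ₗ[K] AdjoinRoot P × AdjoinRoot P where
  toFun z := (AdjoinRoot.mk P (z.1 * a), AdjoinRoot.mk P (z.1 * b + z.2 * c))
  map_add' z w := by
    simp only [Prod.fst_add, Prod.snd_add, Submodule.coe_add, Prod.mk_add_mk, ← map_add]
    congr 2 <;> ring
  map_smul' k z := by
    simp only [Prod.smul_fst, Prod.smul_snd, Submodule.coe_smul, Prod.smul_mk, smul_mul_assoc,
      ← smul_add, AdjoinRoot.smul_mk, RingHom.id_apply]

lemma triangularEncode_apply (P a b c : K[X]) (S T : Submodule K K[X]) (z : S × T) :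
    triangularEncode P a b c S T z =
      (AdjoinRoot.mk P (z.1 * a), AdjoinRoot.mk P (z.1 * b + z.2 * c)) := rfl

lemma triangularEncode_injective {P a b c : K[X]} (hP : P ≠ 0) (ha : a ∣ P) (hc : c ∣ P) :
    Function.Injective (triangularEncode P a b c (degreeLT K (P.natDegree - a.natDegree))
      (degreeLT K (P.natDegree - c.natDegree))) := by
  rw [← LinearMap.ker_eq_bot, LinearMap.ker_eq_bot']
  intro z h
  rw [triangularEncode_apply, Prod.mk_eq_zero, AdjoinRoot.mk_eq_zero, AdjoinRoot.mk_eq_zero] at h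
  obtain ⟨h1, h2⟩ := h
  have hu : (z.1 : K[X]) = 0 := eq_zero_of_dvd_mul hP ha z.1.2 h1
  rw [hu, zero_mul, zero_add] at h2
  have hv : (z.2 : K[X]) = 0 := eq_zero_of_dvd_mul hP hc z.2.2 h2
  exact Prod.ext (Subtype.ext hu) (Subtype.ext hv)

lemma range_triangularEncode {P a b c : K[X]} (hP : P ≠ 0) (ha : a ∣ P) (hc : c ∣ P)
    (hb : a * c ∣ P * b) :
    LinearMap.range (triangularEncode P a b c (degreeLT K (P.natDegree - a.natDegree))
      (degreeLT K (P.natDegree - c.natDegree))) =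
      (triangularCode P a b c).restrictScalars K := by
  ext z
  rw [Submodule.restrictScalars_mem, mem_triangularCode]
  constructor
  · rintro ⟨w, rfl⟩
    exact ⟨w.1, w.2, (triangularEncode_apply ..).symm⟩
  · rintro ⟨u, v, rfl⟩
    obtain ⟨d, hd⟩ := ha
    obtain ⟨e, he⟩ := hc
    obtain ⟨k, hk⟩ := hb
    have ha0 : a ≠ 0 := by rintro rfl; simp [hP] at hd
    have hk' : d * b = c * k := mul_left_cancel₀ ha0 (by linear_combination hk - b * hd)
    obtain ⟨w, hw⟩ : ∃ w, w = v + u / d * k := ⟨_, rfl⟩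
    refine ⟨(⟨u % d, mod_mem_degreeLT hP hd u⟩, ⟨w % e, mod_mem_degreeLT hP he w⟩), ?_⟩
    have hu := EuclideanDomain.mod_add_div u d
    have hwe := EuclideanDomain.mod_add_div w e
    rw [triangularEncode_apply, Prod.mk.injEq, AdjoinRoot.mk_eq_mk, AdjoinRoot.mk_eq_mk]
    constructor
    · exact ⟨-(u / d), by linear_combination a * hu + (u / d) * hd⟩
    · exact ⟨-(w / e), by
        linear_combination b * hu + c * hwe + c * hw + (w / e) * he - (u / d) * hk'⟩

lemma finrank_triangularCode {P a b c : K[X]} (hP : P ≠ 0) (ha : a ∣ P) (hc : c ∣ P)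
    (hb : a * c ∣ P * b) :
    Module.finrank K ((triangularCode P a b c).restrictScalars K) =
      2 * P.natDegree - a.natDegree - c.natDegree := by
  have finrank_degreeLT (n : ℕ) : Module.finrank K (degreeLT K n) = n := by
    rw [(degreeLTEquiv K n).finrank_eq, Module.finrank_fin_fun]
  have hfin (n : ℕ) : Module.Finite K (degreeLT K n) :=
    Module.Finite.equiv (degreeLTEquiv K n).symm
  have := hfin (P.natDegree - a.natDegree)
  have := hfin (P.natDegree - c.natDegree)
  rw [← range_triangularEncode hP ha hc hb,
    LinearMap.finrank_range_of_inj (triangularEncode_injective hP ha hc), Module.finrank_prod, finrank_degreeLT,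
    finrank_degreeLT]
  have := natDegree_le_of_dvd ha hP
  have := natDegree_le_of_dvd hc hP
  omega

set_option maxHeartbeats 1000000 in
/-- Every quasi-cyclic code of length `2m` and index `2`, viewed as an `R`-submodule of
`R²` with `R = F[x]/(x^m - 1)`, is generated by `(g11, g12)` and `(0, g22)` with
`g11 ∣ x^m - 1`, `g22 ∣ x^m - 1`, `deg g12 < deg g22` and
`g11·g22 ∣ (x^m - 1)·g12`; moreover for any such generators,
`dim_F C = 2m - deg g11 - deg g22`. -/
theorem stmt0 (F : Type) [Field F] [Fintype F] (m : ℕ) (hm : 0 < m)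
    (Cd : Submodule (AdjoinRoot (X ^ m - 1 : F[X]))
      (AdjoinRoot (X ^ m - 1 : F[X]) × AdjoinRoot (X ^ m - 1 : F[X]))) :
    (∃ g11 g12 g22 : F[X],
      Cd = Submodule.span (AdjoinRoot (X ^ m - 1 : F[X]))
        {(AdjoinRoot.mk (X ^ m - 1 : F[X]) g11, AdjoinRoot.mk (X ^ m - 1 : F[X]) g12), (0, AdjoinRoot.mk (X ^ m - 1 : F[X]) g22)} ∧
      g11 ∣ X ^ m - 1 ∧ g22 ∣ X ^ m - 1 ∧ g12.degree < g22.degree ∧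
      g11 * g22 ∣ (X ^ m - 1) * g12) ∧
    (∀ g11 g12 g22 : F[X],
      (Cd = Submodule.span (AdjoinRoot (X ^ m - 1 : F[X]))
        {(AdjoinRoot.mk (X ^ m - 1 : F[X]) g11, AdjoinRoot.mk (X ^ m - 1 : F[X]) g12), (0, AdjoinRoot.mk (X ^ m - 1 : F[X]) g22)} ∧
        g11 ∣ X ^ m - 1 ∧ g22 ∣ X ^ m - 1 ∧ g12.degree < g22.degree ∧
        g11 * g22 ∣ (X ^ m - 1) * g12) →
      Module.finrank F (Cd.restrictScalars F) =
        2 * m - g11.natDegree - g22.natDegree) := by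
  have hP : (X ^ m - 1 : F[X]) ≠ 0 := X_pow_sub_C_ne_zero hm 1
  have hdeg : (X ^ m - 1 : F[X]).natDegree = m := natDegree_X_pow_sub_C (r := (1 : F))
  refine ⟨exists_eq_triangularCode hP Cd, ?_⟩
  rintro a b c ⟨rfl, ha, hc, -, hb⟩
  have h := finrank_triangularCode hP ha hc hb
  rwa [hdeg] at h
end
end

section
/- Suppose g11 and g22 both divide x^m − 1 in F[x]. Then for every polynomial g12 in F[x], the condition g11·g22 divides (x^m − 1)·g12 is equivalent to the condition gcd(g11, g22) divides g12. -/
open Polynomial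

noncomputable section

/-- If the number of elements of a finite field is coprime to `m`, then `m` is nonzero in it. -/
theorem natCast_ne_zero_of_coprime_card (F : Type*) [Field F] [Fintype F] {m : ℕ}
    (hqm : Nat.Coprime (Fintype.card F) m) : (m : F) ≠ 0 := by
  intro h
  have hcard : ringChar F ∣ Fintype.card F := ringChar.dvd (Nat.cast_card_eq_zero F)
  have h1 : ringChar F ∣ 1 := hqm ▸ Nat.dvd_gcd hcard (ringChar.dvd h)
  exact CharP.ringChar_ne_one (Nat.dvd_one.mp h1)

/-- For two divisors `a` and `b` of a squarefree element `s`, `a * b` divides `s * c` exactly when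
`gcd a b` divides `c`. -/
theorem Squarefree.mul_dvd_mul_iff_gcd_dvd {R : Type*} [CommRing R] [IsDomain R] [GCDMonoid R]
    {s a b : R} (hs : Squarefree s) (hs0 : s ≠ 0) (ha : a ∣ s) (hb : b ∣ s) (c : R) :
    a * b ∣ s * c ↔ gcd a b ∣ c := by
  obtain ⟨e, rfl⟩ := lcm_dvd ha hb
  have hl : lcm a b ≠ 0 := left_ne_zero_of_mul hs0
  have hrel : IsRelPrime (gcd a b) e := by
    intro x hx hxe
    exact hs x (mul_dvd_mul (hx.trans ((gcd_dvd_left a b).trans (dvd_lcm_left a b))) hxe)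
  rw [← (gcd_mul_lcm a b).dvd_iff_dvd_left, mul_comm (gcd a b), mul_assoc, mul_dvd_mul_iff_left hl]
  exact ⟨hrel.dvd_of_dvd_mul_left, fun h => h.mul_left e⟩

/-- If `g11` and `g22` both divide `x^m - 1` (with `gcd(q,m) = 1`), then for every
`g12`, `g11·g22 ∣ (x^m - 1)·g12` iff `gcd(g11, g22) ∣ g12`. -/
theorem stmt1 (F : Type) [Field F] [Fintype F] [DecidableEq F] (m : ℕ) (hm : 0 < m)
    (hqm : Nat.Coprime (Fintype.card F) m)
    (g11 g22 : F[X]) (h11 : g11 ∣ X ^ m - 1) (h22 : g22 ∣ X ^ m - 1) :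
    ∀ g12 : F[X], g11 * g22 ∣ (X ^ m - 1) * g12 ↔ gcd g11 g22 ∣ g12 := by
  have hsep : (X ^ m - 1 : F[X]).Separable :=
    X_pow_sub_one_separable_iff.mpr (natCast_ne_zero_of_coprime_card F hqm)
  exact hsep.squarefree.mul_dvd_mul_iff_gcd_dvd hsep.ne_zero h11 h22
end
end

section
/- The code C is Euclidean LCD if and only if all of the following four conditions hold: (I) g is self-reciprocal; (II) l is self-reciprocal; (III) gcd(t22(x), g12(x)) = 1; (IV) gcd(r22(x), g11(x)·ḡ11(x) + g12(x)·ḡ12(x)) = 1. -/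
open Polynomial

noncomputable section

/-- The coefficient vector (of length `m`) of the canonical representative of an
element of `R = F[x]/(x^m - 1)`.  Under the identification of `R²` with `F^{2m}` a pair
`(a(x), b(x))` corresponds to the concatenation of the two coefficient vectors. -/
def qcToVec {F : Type} [Field F] {m : ℕ} (hm : 0 < m)
    (a : AdjoinRoot (X ^ m - 1 : F[X])) : Fin m → F := fun i =>
  (AdjoinRoot.modByMonicHom
    (show (X ^ m - 1 : F[X]).Monic by
      simpa using monic_X_pow_sub_C (1 : F) hm.ne') a).coeff i

/-- The Euclidean inner product `⟨u,v⟩_e = Σ u_i v_i` on `R × R`, via the identification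
of `R²` with `F^{2m}` by coefficient vectors. -/
def qcEuclInner {F : Type} [Field F] {m : ℕ} (hm : 0 < m)
    (u v : AdjoinRoot (X ^ m - 1 : F[X]) × AdjoinRoot (X ^ m - 1 : F[X])) : F :=
  (∑ i, qcToVec hm u.1 i * qcToVec hm v.1 i) +
    ∑ i, qcToVec hm u.2 i * qcToVec hm v.2 i

/-- A code `C ⊆ R²` is LCD with respect to a pairing `inner` if it meets its dual
trivially, i.e. `C ∩ C^⊥ = {0}` where `C^⊥ = {v : ∀ c ∈ C, inner c v = 0}`. -/
def IsLCDWith {F : Type} [Field F] {m : ℕ}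
    (Cd : Submodule (AdjoinRoot (X ^ m - 1 : F[X]))
      (AdjoinRoot (X ^ m - 1 : F[X]) × AdjoinRoot (X ^ m - 1 : F[X])))
    (inner : (AdjoinRoot (X ^ m - 1 : F[X]) × AdjoinRoot (X ^ m - 1 : F[X])) →
      (AdjoinRoot (X ^ m - 1 : F[X]) × AdjoinRoot (X ^ m - 1 : F[X])) → F) : Prop :=
  ∀ v ∈ Cd, (∀ c ∈ Cd, inner c v = 0) → v = 0

/-- `f` is self-reciprocal: the reciprocal polynomial `f*(x) = x^(deg f)·f(1/x)` is a
nonzero scalar multiple of `f`. -/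
def IsSelfReciprocal {F : Type} [Field F] (f : F[X]) : Prop :=
  ∃ α : F, α ≠ 0 ∧ f.reverse = Polynomial.C α * f

section Roots

variable {F K : Type*} [Field F] [Field K] [Algebra F K]

theorem Polynomial.Separable.dvd_of_aeval_eq_zero [IsAlgClosed K] {f h : F[X]}
    (hf : f.Separable) (H : ∀ x : K, aeval x f = 0 → aeval x h = 0) : f ∣ h := by
  rcases eq_or_ne h 0 with rfl | hh
  · exact dvd_zero f
  have hh' : h.map (algebraMap F K) ≠ 0 := (Polynomial.map_ne_zero_iff (algebraMap F K).injective).2 hh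
  have hf' : f.map (algebraMap F K) ≠ 0 :=
    (Polynomial.map_ne_zero_iff (algebraMap F K).injective).2 hf.ne_zero
  refine (map_dvd_map' (algebraMap F K)).1
    ((IsAlgClosed.splits _).dvd_of_roots_le_roots hf' ?_)
  rw [Multiset.le_iff_subset (nodup_roots hf.map)]
  intro x hx
  rw [mem_roots hf', IsRoot.def, eval_map_algebraMap] at hx
  rw [mem_roots hh', IsRoot.def, eval_map_algebraMap]
  exact H x hx

theorem aeval_ne_zero_of_mul_dvd_separable {f g h : F[X]} (hf : f.Separable) (hgh : g * h ∣ f)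
    {x : K} (hg : aeval x g = 0) : aeval x h ≠ 0 := by
  intro hh
  obtain ⟨a, b, hab⟩ := (hf.of_dvd hgh).isCoprime
  have := congrArg (aeval x) hab
  simp [hg, hh] at this

theorem aeval_gcd_eq_zero_iff [DecidableEq F] {f g : F[X]} {x : K} :
    aeval x (gcd f g) = 0 ↔ aeval x f = 0 ∧ aeval x g = 0 := by
  refine ⟨fun h => ⟨aeval_eq_zero_of_dvd_aeval_eq_zero (gcd_dvd_left f g) h,
    aeval_eq_zero_of_dvd_aeval_eq_zero (gcd_dvd_right f g) h⟩, fun ⟨hf, hg⟩ => ?_⟩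
  exact aeval_eq_zero_of_dvd_aeval_eq_zero
    (dvd_gcd (minpoly.dvd F x hf) (minpoly.dvd F x hg)) (minpoly.aeval F x)

theorem aeval_lcm_eq_zero_iff [DecidableEq F] {f g : F[X]} {x : K} :
    aeval x (lcm f g) = 0 ↔ aeval x f = 0 ∨ aeval x g = 0 := by
  constructor
  · intro h
    have := aeval_eq_zero_of_dvd_aeval_eq_zero
      (lcm_dvd (dvd_mul_right f g) (dvd_mul_left g f)) h
    simpa using this
  · rintro (h | h)
    · exact aeval_eq_zero_of_dvd_aeval_eq_zero (dvd_lcm_left f g) h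
    · exact aeval_eq_zero_of_dvd_aeval_eq_zero (dvd_lcm_right f g) h

theorem aeval_div_eq_zero_iff {f g h : F[X]} (hf : f.Separable) (hg : g ∣ f) (hh : h ∣ g)
    {x : K} : aeval x (g / h) = 0 ↔ aeval x g = 0 ∧ aeval x h ≠ 0 := by
  have hh0 : h ≠ 0 := ne_zero_of_dvd_ne_zero hf.ne_zero (hh.trans hg)
  have e := EuclideanDomain.mul_div_cancel' hh0 hh
  have e' : aeval x h * aeval x (g / h) = aeval x g := by rw [← map_mul, e]
  rw [← e']
  refine ⟨fun h0 => ⟨by simp [h0], ?_⟩, fun h0 => ?_⟩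
  · refine aeval_ne_zero_of_mul_dvd_separable hf ?_ h0
    rwa [mul_comm, e]
  · exact (mul_eq_zero.1 h0.1).resolve_left h0.2

theorem aeval_reverse_eq_zero_iff {f : F[X]} {x : K} (hx : x ≠ 0) :
    aeval x f.reverse = 0 ↔ aeval x⁻¹ f = 0 := by
  let := invertibleOfNonzero (inv_ne_zero hx)
  simpa [aeval_def] using eval₂_reverse_eq_zero_iff (algebraMap F K) x⁻¹ f

theorem aeval_reflect_eq {f : F[X]} {n : ℕ} (hf : f.natDegree ≤ n) {x : K} (hx : x ≠ 0) :
    aeval x (reflect n f) = x ^ n * aeval x⁻¹ f := by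
  let := invertibleOfNonzero (inv_ne_zero hx)
  have := eval₂_reflect_mul_pow (algebraMap F K) x⁻¹ n f hf
  simp only [invOf_eq_inv, inv_inv] at this
  rw [aeval_def, aeval_def, ← this, inv_pow]
  field_simp

end Roots

theorem isSelfReciprocal_iff_aeval {F : Type} {K : Type*} [Field F] [Field K] [Algebra F K]
    [IsAlgClosed K] {f : F[X]} (hf : f.Separable) (h0 : f.coeff 0 ≠ 0) :
    IsSelfReciprocal f ↔ ∀ x : K, aeval x f = 0 → aeval x⁻¹ f = 0 := by
  have hx0 : ∀ x : K, aeval x f = 0 → x ≠ 0 := by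
    rintro x hx rfl
    rw [← coeff_zero_eq_aeval_zero'] at hx
    simp [h0] at hx
  constructor
  · rintro ⟨α, -, h⟩ x hx
    rw [← aeval_reverse_eq_zero_iff (hx0 x hx), h, map_mul, hx, mul_zero]
  · intro H
    have hdvd : f ∣ f.reverse := hf.dvd_of_aeval_eq_zero (K := K)
      fun x hx => (aeval_reverse_eq_zero_iff (hx0 x hx)).2 (H x hx)
    have hr : f.reverse ≠ 0 := by simpa using hf.ne_zero
    obtain ⟨u, hu⟩ := associated_of_dvd_of_natDegree_le hdvd hr f.reverse_natDegree_le
    obtain ⟨α, hα, hα'⟩ := isUnit_iff.1 u.isUnit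
    exact ⟨α, hα.ne_zero, by rw [← hu, ← hα', mul_comm]⟩

section TraceForm

variable {F : Type} [Field F] {m : ℕ}

local notation "R" => AdjoinRoot (X ^ m - 1 : F[X])

theorem root_pow_eq_one : (AdjoinRoot.root (X ^ m - 1 : F[X])) ^ m = 1 := by
  have := AdjoinRoot.mk_self (f := (X ^ m - 1 : F[X]))
  rw [map_sub, map_pow, AdjoinRoot.mk_X, map_one] at this
  exact sub_eq_zero.1 this

/-- The conjugation `x ↦ x⁻¹` on `F[x]/(x^m - 1)`. -/
def qcConj : R →ₐ[F] R :=
  AdjoinRoot.liftAlgHom _ (Algebra.ofId F R) (AdjoinRoot.root (X ^ m - 1 : F[X]) ^ (m - 1)) (by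
    simp [← pow_mul, mul_comm (m - 1) m, pow_mul _ m, root_pow_eq_one])

theorem qcConj_root : qcConj (AdjoinRoot.root (X ^ m - 1 : F[X])) =
    AdjoinRoot.root (X ^ m - 1 : F[X]) ^ (m - 1) := by
  simp [qcConj]

theorem qcConj_mk (f : F[X]) : qcConj (AdjoinRoot.mk (X ^ m - 1 : F[X]) f) =
    AdjoinRoot.mk (X ^ m - 1 : F[X]) (f.comp (X ^ (m - 1))) := by
  rw [← AdjoinRoot.aeval_eq, ← AdjoinRoot.aeval_eq, ← aeval_algHom_apply, aeval_comp, qcConj_root]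
  simp

theorem monic_X_pow_sub_one (hm : 0 < m) : (X ^ m - 1 : F[X]).Monic := by
  simpa using monic_X_pow_sub_C (1 : F) hm.ne'

theorem degree_X_pow_sub_one (hm : 0 < m) : (X ^ m - 1 : F[X]).degree = m := by
  simpa using degree_X_pow_sub_C hm (1 : F)

theorem qcToVec_root_pow (hm : 0 < m) (n : ℕ) (i : Fin m) :
    qcToVec hm (AdjoinRoot.root (X ^ m - 1 : F[X]) ^ n) i = if n % m = i then 1 else 0 := by
  have h : AdjoinRoot.root (X ^ m - 1 : F[X]) ^ n = AdjoinRoot.mk _ (X ^ (n % m)) := by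
    rw [map_pow, AdjoinRoot.mk_X]
    conv_lhs => rw [← Nat.mod_add_div n m, pow_add, pow_mul, root_pow_eq_one, one_pow, mul_one]
  rw [h, qcToVec, AdjoinRoot.modByMonicHom_mk, (modByMonic_eq_self_iff (monic_X_pow_sub_one hm)).2,
    coeff_X_pow]
  · simp [eq_comm]
  · rw [degree_X_pow_sub_one hm, degree_X_pow]
    exact_mod_cast Nat.mod_lt n hm

theorem sum_qcToVec_smul (hm : 0 < m) (u : R) :
    ∑ i, qcToVec hm u i • AdjoinRoot.root (X ^ m - 1 : F[X]) ^ (i : ℕ) = u := by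
  have hM := monic_X_pow_sub_one (F := F) hm
  conv_rhs => rw [← AdjoinRoot.mk_leftInverse hM u]
  have hdeg : (AdjoinRoot.modByMonicHom hM u).natDegree < m := by
    obtain ⟨f, rfl⟩ := AdjoinRoot.mk_surjective u
    have hlt := degree_modByMonic_lt f hM
    rw [degree_X_pow_sub_one hm] at hlt
    rw [AdjoinRoot.modByMonicHom_mk]
    rcases eq_or_ne (f %ₘ (X ^ m - 1)) 0 with h0 | h0
    · simpa [h0] using hm
    · exact (natDegree_lt_iff_degree_lt h0).2 hlt
  conv_rhs => rw [as_sum_range_C_mul_X_pow' _ hdeg]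
  rw [map_sum, Finset.sum_range]
  refine Finset.sum_congr rfl fun i _ => ?_
  simp [qcToVec, Algebra.smul_def, AdjoinRoot.algebraMap_eq]

/-- The constant coefficient of the canonical representative. -/
def qcTrace (hm : 0 < m) : R →ₗ[F] F where
  toFun a := qcToVec hm a ⟨0, hm⟩
  map_add' a b := by simp [qcToVec]
  map_smul' a b := by simp [qcToVec]

theorem qcTrace_root_pow_mul_conj (hm : 0 < m) (i j : Fin m) :
    qcTrace hm (AdjoinRoot.root (X ^ m - 1 : F[X]) ^ (i : ℕ) *
      qcConj (AdjoinRoot.root (X ^ m - 1 : F[X]) ^ (j : ℕ))) = if i = j then 1 else 0 := by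
  rw [map_pow, qcConj_root, ← pow_mul, ← pow_add]
  have h := qcToVec_root_pow (F := F) hm (i + (m - 1) * j) ⟨0, hm⟩
  refine h.trans (if_congr ?_ rfl rfl)
  have e : i + (m - 1) * j + j = i + m * j := by
    obtain ⟨k, rfl⟩ := Nat.exists_eq_add_of_lt hm
    simp; ring
  constructor
  · intro h0
    have : (i + (m - 1) * j + j) % m = (i + m * j) % m := by rw [e]
    rw [Nat.add_mod, h0, Nat.add_mul_mod_self_left, Nat.mod_eq_of_lt i.2, zero_add, Nat.mod_mod,
      Nat.mod_eq_of_lt j.2] at this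
    exact (Fin.ext this).symm
  · rintro rfl
    have : (i : ℕ) + (m - 1) * i = m * i := by omega
    rw [this, Nat.mul_mod_right]

theorem sum_qcToVec_mul (hm : 0 < m) (u v : R) :
    ∑ i, qcToVec hm u i * qcToVec hm v i = qcTrace hm (u * qcConj v) := by
  conv_rhs => rw [← sum_qcToVec_smul hm u, ← sum_qcToVec_smul hm v]
  simp only [map_sum, map_smul, Finset.sum_mul_sum, smul_mul_smul_comm, qcTrace_root_pow_mul_conj]
  simp

theorem eq_zero_of_qcTrace_mul (hm : 0 < m) {w : R} (h : ∀ c, qcTrace hm (c * w) = 0) :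
    w = 0 := by
  rw [← sum_qcToVec_smul hm w]
  refine Finset.sum_eq_zero fun i _ => ?_
  have := sum_qcToVec_mul hm w (AdjoinRoot.root (X ^ m - 1 : F[X]) ^ (i : ℕ))
  rw [mul_comm, h] at this
  simp [qcToVec_root_pow, Nat.mod_eq_of_lt, Fin.val_inj] at this
  simp [this]

theorem forall_mem_span_qcEuclInner_eq_zero_iff (hm : 0 < m) (a b d : R) (v : R × R) :
    (∀ c ∈ Submodule.span R {(a, b), (0, d)}, qcEuclInner hm c v = 0) ↔
      a * qcConj v.1 + b * qcConj v.2 = 0 ∧ d * qcConj v.2 = 0 := by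
  simp only [qcEuclInner, sum_qcToVec_mul, ← map_add]
  constructor
  · intro H
    constructor <;> refine eq_zero_of_qcTrace_mul hm fun c => ?_
    · rw [mul_add, ← mul_assoc, ← mul_assoc]
      exact H (c • (a, b)) (Submodule.smul_mem _ _ (Submodule.subset_span (by simp)))
    · have := H (c • (0, d)) (Submodule.smul_mem _ _ (Submodule.subset_span (by simp)))
      simpa [mul_assoc] using this
  · rintro ⟨h₁, h₂⟩ c hc
    obtain ⟨s, t, rfl⟩ := Submodule.mem_span_pair.1 hc
    have : (s • (a, b) + t • ((0 : R), d)).1 * qcConj v.1 +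
        (s • (a, b) + t • ((0 : R), d)).2 * qcConj v.2 = 0 := by
      simp only [Prod.fst_add, Prod.snd_add, Prod.smul_fst, Prod.smul_snd, smul_eq_mul]
      linear_combination s * h₁ + t * h₂
    rw [this, map_zero]

end TraceForm

section Pointwise

variable {F : Type} {K : Type*} [Field F] [Field K] [Algebra F K] {m : ℕ}

theorem aeval_X_pow_sub_one_eq_zero_iff {x : K} :
    aeval x (X ^ m - 1 : F[X]) = 0 ↔ x ^ m = 1 := by
  simp [sub_eq_zero]

theorem aeval_comp_X_pow_pred (hm : 0 < m) {x : K} (hx : x ^ m = 1) (f : F[X]) :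
    aeval x (f.comp (X ^ (m - 1))) = aeval x⁻¹ f := by
  have : x ^ (m - 1) = x⁻¹ := by
    refine eq_inv_of_mul_eq_one_left ?_
    rw [← pow_succ, Nat.sub_add_cancel hm, hx]
  simp [aeval_comp, this]

theorem mk_eq_zero_iff_aeval [IsAlgClosed K] (hs : (X ^ m - 1 : F[X]).Separable) (f : F[X]) :
    AdjoinRoot.mk (X ^ m - 1 : F[X]) f = 0 ↔ ∀ x : K, x ^ m = 1 → aeval x f = 0 := by
  rw [AdjoinRoot.mk_eq_zero]
  constructor
  · intro h x hx
    exact aeval_eq_zero_of_dvd_aeval_eq_zero h (aeval_X_pow_sub_one_eq_zero_iff.2 hx)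
  · intro h
    exact hs.dvd_of_aeval_eq_zero (K := K)
      fun x hx => h x (aeval_X_pow_sub_one_eq_zero_iff.1 hx)

/-- The LCD property may be tested at each `m`-th root of unity separately. -/
theorem isLCDWith_span_pair_iff [IsAlgClosed K] (hm : 0 < m)
    (hs : (X ^ m - 1 : F[X]).Separable) (f g h : F[X]) :
    IsLCDWith (Submodule.span (AdjoinRoot (X ^ m - 1 : F[X]))
        {(AdjoinRoot.mk (X ^ m - 1 : F[X]) f, AdjoinRoot.mk (X ^ m - 1 : F[X]) g),
          (0, AdjoinRoot.mk (X ^ m - 1 : F[X]) h)}) (qcEuclInner hm) ↔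
      ∀ x : K, x ^ m = 1 → ∀ a b : F[X],
        aeval x⁻¹ f * aeval x (a * f) + aeval x⁻¹ g * aeval x (a * g + b * h) = 0 →
        aeval x⁻¹ h * aeval x (a * g + b * h) = 0 →
        aeval x (a * f) = 0 ∧ aeval x (a * g + b * h) = 0 := by
  have key (x : K) (hx : x ^ m = 1) (p : F[X]) :
      aeval x (p.comp (X ^ (m - 1))) = aeval x⁻¹ p := aeval_comp_X_pow_pred hm hx p
  have hinv {x : K} (hx : x ^ m = 1) : x⁻¹ ^ m = 1 := by rw [inv_pow, hx, inv_one]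
  constructor
  · intro H x hx a b h₁ h₂
    obtain ⟨e, he⟩ := minpoly.dvd F x (aeval_X_pow_sub_one_eq_zero_iff.2 hx)
    have hex : aeval x e ≠ 0 :=
      aeval_ne_zero_of_mul_dvd_separable hs (dvd_of_eq he.symm) (minpoly.aeval F x)
    have transfer (p : F[X]) (hp : aeval x p = 0) (y : K) (hy : y ^ m = 1) :
        aeval y (e * p) = 0 := by
      refine aeval_eq_zero_of_dvd_aeval_eq_zero ?_ (aeval_X_pow_sub_one_eq_zero_iff (F := F).2 hy)
      rw [he, mul_comm]
      exact mul_dvd_mul_left e (minpoly.dvd F x hp)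
    have hv := H (AdjoinRoot.mk _ (e * (a * f)), AdjoinRoot.mk _ (e * (a * g + b * h)))
      (Submodule.mem_span_pair.2 ⟨AdjoinRoot.mk _ (e * a), AdjoinRoot.mk _ (e * b), by
        ext <;> simp <;> ring⟩) ?_
    · rw [Prod.mk_eq_zero, mk_eq_zero_iff_aeval (K := K) hs, mk_eq_zero_iff_aeval (K := K) hs] at hv
      have e₁ := hv.1 x hx
      have e₂ := hv.2 x hx
      rw [map_mul] at e₁ e₂
      exact ⟨(mul_eq_zero.1 e₁).resolve_left hex, (mul_eq_zero.1 e₂).resolve_left hex⟩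
    · rw [forall_mem_span_qcEuclInner_eq_zero_iff]
      simp only [qcConj_mk, ← map_mul, ← map_add]
      rw [mk_eq_zero_iff_aeval (K := K) hs, mk_eq_zero_iff_aeval (K := K) hs]
      constructor
      · intro y hy
        have := transfer (f.comp (X ^ (m - 1)) * (a * f) + g.comp (X ^ (m - 1)) * (a * g + b * h))
          (by rw [map_add, map_mul, map_mul _ (g.comp _), key x hx, key x hx, h₁]) y⁻¹ (hinv hy)
        rw [map_add, map_mul, map_mul, key y hy, key y hy]
        simp only [map_mul, map_add, key y⁻¹ (hinv hy), inv_inv] at this ⊢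
        linear_combination this
      · intro y hy
        have := transfer (h.comp (X ^ (m - 1)) * (a * g + b * h))
          (by rw [map_mul, key x hx, h₂]) y⁻¹ (hinv hy)
        rw [map_mul, key y hy]
        simp only [map_mul, map_add, key y⁻¹ (hinv hy), inv_inv] at this ⊢
        linear_combination this
  · intro H v hv hdual
    obtain ⟨s, t, rfl⟩ := Submodule.mem_span_pair.1 hv
    obtain ⟨a, rfl⟩ := AdjoinRoot.mk_surjective s
    obtain ⟨b, rfl⟩ := AdjoinRoot.mk_surjective t
    rw [forall_mem_span_qcEuclInner_eq_zero_iff] at hdual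
    simp only [Prod.smul_mk, Prod.mk_add_mk, smul_eq_mul, mul_zero, add_zero, ← map_mul,
      ← map_add, qcConj_mk] at hdual ⊢
    rw [mk_eq_zero_iff_aeval (K := K) hs, mk_eq_zero_iff_aeval (K := K) hs] at hdual
    rw [Prod.mk_eq_zero, mk_eq_zero_iff_aeval (K := K) hs, mk_eq_zero_iff_aeval (K := K) hs,
      ← forall₂_and]
    intro x hx
    refine H x hx a b ?_ ?_
    · have := hdual.1 x⁻¹ (hinv hx)
      rwa [map_add, map_mul, map_mul, key _ (hinv hx), key _ (hinv hx), inv_inv] at this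
    · have := hdual.2 x⁻¹ (hinv hx)
      rwa [map_mul, key _ (hinv hx), inv_inv] at this

/-- The pointwise LCD condition in terms of the values of the generators at mutually inverse
roots of unity. -/
theorem forall_aeval_iff (hm : 0 < m) (f g h : F[X])
    (hfh : ∀ x : K, x ^ m = 1 → aeval x f = 0 → aeval x h = 0 → aeval x g = 0) :
    (∀ x : K, x ^ m = 1 → ∀ a b : F[X],
        aeval x⁻¹ f * aeval x (a * f) + aeval x⁻¹ g * aeval x (a * g + b * h) = 0 →
        aeval x⁻¹ h * aeval x (a * g + b * h) = 0 →
        aeval x (a * f) = 0 ∧ aeval x (a * g + b * h) = 0) ↔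
      (∀ x : K, x ^ m = 1 → aeval x f = 0 → aeval x h = 0 → aeval x⁻¹ f = 0 ∧ aeval x⁻¹ h = 0) ∧
      (∀ x : K, x ^ m = 1 → aeval x f ≠ 0 → aeval x h ≠ 0 → aeval x⁻¹ f ≠ 0 ∧ aeval x⁻¹ h ≠ 0) ∧
      (∀ x : K, x ^ m = 1 → aeval x f ≠ 0 → aeval x h = 0 →
        ¬ (aeval x⁻¹ f ≠ 0 ∧ aeval x⁻¹ h = 0) → aeval x g ≠ 0) ∧
      (∀ x : K, x ^ m = 1 → aeval x f ≠ 0 → aeval x h = 0 → aeval x⁻¹ f ≠ 0 → aeval x⁻¹ h = 0 →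
        aeval x f * aeval x⁻¹ f + aeval x g * aeval x⁻¹ g ≠ 0) := by
  have hinv {x : K} (hx : x ^ m = 1) : x⁻¹ ^ m = 1 := by rw [inv_pow, hx, inv_one]
  constructor
  · intro H
    have hI : ∀ x : K, x ^ m = 1 → aeval x f = 0 → aeval x h = 0 →
        aeval x⁻¹ f = 0 ∧ aeval x⁻¹ h = 0 := by
      intro x hx hf hh
      have hg := hfh x hx hf hh
      have h₁ := H x⁻¹ (hinv hx) 1 0
      have h₂ := H x⁻¹ (hinv hx) 0 1
      simp only [inv_inv, hf, hg, hh, zero_mul, add_zero, one_mul, zero_add, true_imp_iff]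
        at h₁ h₂
      exact ⟨h₁.1, h₂.2⟩
    have hII : ∀ x : K, x ^ m = 1 → aeval x f ≠ 0 → aeval x h ≠ 0 →
        aeval x⁻¹ f ≠ 0 ∧ aeval x⁻¹ h ≠ 0 := by
      intro x hx hf hh
      have hh' : aeval x⁻¹ h ≠ 0 := by
        intro hh'
        have h₁ := H x hx (-(g.comp (X ^ (m - 1)) * h)) (f.comp (X ^ (m - 1)) * f +
          g.comp (X ^ (m - 1)) * g)
        simp only [map_mul, map_add, map_neg, aeval_comp_X_pow_pred hm hx, hh', zero_mul,
          true_imp_iff] at h₁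
        have h₂ := (h₁ (by ring)).2
        have hf' : aeval x⁻¹ f * (aeval x f * aeval x h) = 0 := by linear_combination h₂
        have hf'' := (mul_eq_zero.1 hf').resolve_right (mul_ne_zero hf hh)
        have := hI x⁻¹ (hinv hx) hf'' hh'
        rw [inv_inv] at this
        exact hf this.1
      refine ⟨fun hf' => ?_, hh'⟩
      have h₁ := (H x hx h (-g) (by rw [hf']; simp; ring_nf; simp) (by simp; ring_nf; simp)).1
      rw [map_mul] at h₁
      exact mul_ne_zero hh hf h₁
    refine ⟨hI, hII, ?_, ?_⟩
    · intro x hx hf hh hn hg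
      have h₁ := H x hx 1 0
      have h₂ := hI x⁻¹ (hinv hx)
      have h₃ := hII x⁻¹ (hinv hx)
      simp only [inv_inv, one_mul, zero_mul, add_zero, hg, mul_zero, true_imp_iff] at h₁ h₂ h₃
      grind
    · intro x hx hf hh hf' hh' h0
      have h₁ := H x hx 1 0
      simp only [one_mul, zero_mul, add_zero, hh', true_imp_iff] at h₁
      exact hf (h₁ (by linear_combination h0)).1
  · rintro ⟨hI, hII, hIII, hIV⟩ x hx a b h₁ h₂
    have i₂ := hI x⁻¹ (hinv hx)
    have k₂ := hIII x⁻¹ (hinv hx)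
    rw [inv_inv] at i₂ k₂
    simp only [map_mul, map_add] at h₁ h₂ ⊢
    by_cases hf : aeval x f = 0
    · rw [hf, mul_zero] at h₁ ⊢
      refine ⟨rfl, ?_⟩
      by_cases hh : aeval x h = 0
      · rw [hfh x hx hf hh, hh]; ring
      by_cases hh' : aeval x⁻¹ h = 0
      · have hf' : aeval x⁻¹ f ≠ 0 := fun hf' => hh (i₂ hf' hh').2
        have hg' := k₂ hf' hh' fun h => h.1 hf
        rw [mul_zero, zero_add] at h₁
        exact (mul_eq_zero.1 h₁).resolve_left hg'
      · exact (mul_eq_zero.1 h₂).resolve_left hh'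
    by_cases hh : aeval x h = 0
    · rw [hh, mul_zero, add_zero] at h₁ h₂ ⊢
      suffices ha : aeval x a = 0 by simp [ha]
      by_cases hn : aeval x⁻¹ f ≠ 0 ∧ aeval x⁻¹ h = 0
      · refine (mul_eq_zero.1 ?_).resolve_right (hIV x hx hf hh hn.1 hn.2)
        linear_combination h₁
      · have hh' : aeval x⁻¹ h ≠ 0 := fun hh' =>
          hf (i₂ (by_contra fun hf' => hn ⟨hf', hh'⟩) hh').1
        exact (mul_eq_zero.1 ((mul_eq_zero.1 h₂).resolve_left hh')).resolve_right
          (hIII x hx hf hh hn)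
    · obtain ⟨hf', hh'⟩ := hII x hx hf hh
      have h₃ := (mul_eq_zero.1 h₂).resolve_left hh'
      rw [h₃, mul_zero, add_zero] at h₁
      exact ⟨(mul_eq_zero.1 h₁).resolve_left hf', h₃⟩

end Pointwise

/-- Characterization of Euclidean LCD quasi-cyclic codes of index 2:
`C = ⟨(g11, g12), (0, g22)⟩` is Euclidean LCD iff (I) `g` is self-reciprocal,
(II) `l` is self-reciprocal, (III) `gcd(t22, g12) = 1`, and
(IV) `gcd(r22, g11·ḡ11 + g12·ḡ12) = 1`. -/
theorem stmt3 (F : Type) [Field F] [Fintype F] [DecidableEq F] (m : ℕ) (hm : 0 < m)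
    (hqm : Nat.Coprime (Fintype.card F) m)
    (g11 g12 g22 : F[X])
    (h1 : g11 ∣ X ^ m - 1) (h2 : g22 ∣ X ^ m - 1)
    (h3 : g12.degree < g22.degree) (h4 : g11 * g22 ∣ (X ^ m - 1) * g12)
    (g l g11' g22' r11 t11 r22 t22 : F[X])
    (hg : g = gcd g11 g22) (hl : l = (X ^ m - 1) / lcm g11 g22)
    (h11' : g11' = g11 / g) (h22' : g22' = g22 / g)
    (hr11 : r11 = gcd g11' g11'.reverse) (ht11 : t11 = g11' / r11)
    (hr22 : r22 = gcd g22' g22'.reverse) (ht22 : t22 = g22' / r22)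
    :
    IsLCDWith
      (Submodule.span (AdjoinRoot (X ^ m - 1 : F[X]))
        {(AdjoinRoot.mk (X ^ m - 1 : F[X]) g11, AdjoinRoot.mk (X ^ m - 1 : F[X]) g12), (0, AdjoinRoot.mk (X ^ m - 1 : F[X]) g22)})
      (qcEuclInner hm) ↔
    (IsSelfReciprocal g ∧ IsSelfReciprocal l ∧ IsCoprime t22 g12 ∧
      IsCoprime r22 (g11 * reflect m g11 + g12 * reflect m g12)) := by
  let K := AlgebraicClosure F
  have hm0 : (m : F) ≠ 0 := by
    intro h
    obtain ⟨a, b, hab⟩ := Nat.isCoprime_iff_coprime.2 hqm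
    have := congrArg (Int.cast : ℤ → F) hab
    simp [h] at this
  have hs : (X ^ m - 1 : F[X]).Separable := X_pow_sub_one_separable_iff.2 hm0
  have hroot {p : F[X]} (hp : p ∣ X ^ m - 1) {x : K} (hx : aeval x p = 0) : x ^ m = 1 :=
    aeval_X_pow_sub_one_eq_zero_iff.1 (aeval_eq_zero_of_dvd_aeval_eq_zero hp hx)
  have hne {x : K} (hx : x ^ m = 1) : x ≠ 0 := by
    rintro rfl
    simp [hm.ne'] at hx
  have hcoeff {p : F[X]} (hp : p ∣ X ^ m - 1) : p.coeff 0 ≠ 0 := by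
    intro h0
    refine hne (x := 0) (hroot hp ?_) rfl
    rw [← coeff_zero_eq_aeval_zero', h0, map_zero]
  have hself {p : F[X]} (hp : p ∣ X ^ m - 1) :
      IsSelfReciprocal p ↔ ∀ x : K, x ^ m = 1 → aeval x p = 0 → aeval x⁻¹ p = 0 := by
    rw [isSelfReciprocal_iff_aeval (K := K) (hs.of_dvd hp) (hcoeff hp)]
    exact ⟨fun h x _ => h x, fun h x hx => h x (hroot hp hx) hx⟩
  have hgd : g ∣ g22 := hg ▸ gcd_dvd_right _ _
  have hlcm : lcm g11 g22 ∣ X ^ m - 1 := lcm_dvd h1 h2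
  have hld : l ∣ X ^ m - 1 := hl ▸ EuclideanDomain.div_dvd_of_dvd hlcm
  have h22d : g22' ∣ X ^ m - 1 := (h22' ▸ EuclideanDomain.div_dvd_of_dvd hgd).trans h2
  have hrd : r22 ∣ g22' := hr22 ▸ gcd_dvd_left _ _
  have htd : t22 ∣ g22' := ht22 ▸ EuclideanDomain.div_dvd_of_dvd hrd
  have hinv {x : K} (hx : x ^ m = 1) : x⁻¹ ^ m = 1 := by rw [inv_pow, hx, inv_one]
  have g_iff (x : K) : aeval x g = 0 ↔ aeval x g11 = 0 ∧ aeval x g22 = 0 := by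
    rw [hg, aeval_gcd_eq_zero_iff]
  have l_iff (x : K) (hx : x ^ m = 1) : aeval x l = 0 ↔ aeval x g11 ≠ 0 ∧ aeval x g22 ≠ 0 := by
    rw [hl, aeval_div_eq_zero_iff hs dvd_rfl hlcm, aeval_X_pow_sub_one_eq_zero_iff, Ne,
      aeval_lcm_eq_zero_iff, not_or]
    exact and_iff_right hx
  have g22'_iff (x : K) : aeval x g22' = 0 ↔ aeval x g11 ≠ 0 ∧ aeval x g22 = 0 := by
    rw [h22', aeval_div_eq_zero_iff hs h2 hgd, Ne, g_iff]
    tauto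
  have r22_iff (x : K) (hx : x ^ m = 1) :
      aeval x r22 = 0 ↔ aeval x g22' = 0 ∧ aeval x⁻¹ g22' = 0 := by
    rw [hr22, aeval_gcd_eq_zero_iff, aeval_reverse_eq_zero_iff (hne hx)]
  have t22_iff (x : K) (hx : x ^ m = 1) :
      aeval x t22 = 0 ↔ aeval x g22' = 0 ∧ ¬ aeval x⁻¹ g22' = 0 := by
    rw [ht22, aeval_div_eq_zero_iff hs h22d hrd, Ne, r22_iff x hx]
    tauto
  have hdeg {p : F[X]} (hp : p ∣ X ^ m - 1) : p.degree ≤ m := by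
    rw [← degree_X_pow_sub_one (F := F) hm]
    exact degree_le_of_dvd hp hs.ne_zero
  have norm_aeval (x : K) (hx : x ^ m = 1) :
      aeval x (g11 * reflect m g11 + g12 * reflect m g12) =
        aeval x g11 * aeval x⁻¹ g11 + aeval x g12 * aeval x⁻¹ g12 := by
    rw [map_add, map_mul, map_mul, aeval_reflect_eq (natDegree_le_of_degree_le (hdeg h1)) (hne hx),
      aeval_reflect_eq (natDegree_le_of_degree_le (h3.le.trans (hdeg h2))) (hne hx), hx, one_mul,
      one_mul]
  have hcop {p : F[X]} (hp : p ∣ X ^ m - 1) (k : F[X]) :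
      IsCoprime p k ↔ ∀ x : K, x ^ m = 1 → aeval x p = 0 → aeval x k ≠ 0 := by
    rw [isCoprime_iff_aeval_ne_zero_of_isAlgClosed F K]
    exact ⟨fun h x _ h0 => (h x).resolve_left (not_not_intro h0),
      fun h x => or_iff_not_imp_left.2 fun h0 => h x (hroot hp (not_not.1 h0)) (not_not.1 h0)⟩
  have hvanish (x : K) (_ : x ^ m = 1) (hf : aeval x g11 = 0) (hh : aeval x g22 = 0) :
      aeval x g12 = 0 := by
    obtain ⟨k, hk⟩ := h1
    have hk0 : aeval x k ≠ 0 := aeval_ne_zero_of_mul_dvd_separable hs (dvd_of_eq hk.symm) hf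
    have hdvd : g22 ∣ k * g12 := by
      rw [hk, mul_assoc] at h4
      exact (mul_dvd_mul_iff_left (left_ne_zero_of_mul (hk ▸ hs.ne_zero))).1 h4
    have := aeval_eq_zero_of_dvd_aeval_eq_zero hdvd hh
    rw [map_mul] at this
    exact (mul_eq_zero.1 this).resolve_left hk0
  rw [isLCDWith_span_pair_iff (K := K) hm hs, forall_aeval_iff hm _ _ _ hvanish,
    hself (hgd.trans h2), hself hld, hcop (htd.trans h22d), hcop (hrd.trans h22d)]
  refine and_congr ?_ (and_congr ?_ (and_congr ?_ ?_)) <;> refine forall₂_congr fun x hx => ?_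
  · rw [g_iff, g_iff, and_imp]
  · rw [l_iff x hx, l_iff x⁻¹ (hinv hx), and_imp]
  · rw [t22_iff x hx, g22'_iff, g22'_iff, and_imp, and_imp]
  · rw [r22_iff x hx, g22'_iff, g22'_iff, norm_aeval x hx, and_imp, and_imp, and_imp]
end
end

section
/- Assume that g and l are both self-reciprocal. If r11 is not constant (i.e., r11 has positive degree), then the code C is not symplectic LCD. -/
open Polynomial

noncomputable section

/-- The symplectic inner product on `R × R`: writing vectors of `F^{2m}` as `(x1 | x2)`,
`⟨(x1|x2),(y1|y2)⟩_s = ⟨x1,y2⟩_e - ⟨x2,y1⟩_e`. -/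
def qcSympInner {F : Type} [Field F] {m : ℕ} (hm : 0 < m)
    (u v : AdjoinRoot (X ^ m - 1 : F[X]) × AdjoinRoot (X ^ m - 1 : F[X])) : F :=
  (∑ i, qcToVec hm u.1 i * qcToVec hm v.2 i) -
    ∑ i, qcToVec hm u.2 i * qcToVec hm v.1 i

theorem reverse_X_pow_sub_one {F : Type} [Field F] (m : ℕ) :
    (X ^ m - 1 : F[X]).reverse = 1 - X ^ m := by
  have hd : (X ^ m - 1 : F[X]).natDegree = m := by
    simpa using natDegree_X_pow_sub_C (n := m) (r := (1 : F))
  rw [reverse, hd, reflect_sub, reflect_one]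
  have := reflect_monomial m m (R := F)
  simp_all [revAt_le]

theorem reverse_reverse_of_coeff_zero_ne_zero {F : Type} [Field F] {f : F[X]}
    (hf : f.coeff 0 ≠ 0) : f.reverse.reverse = f := by
  have hd : f.reverse.natDegree = f.natDegree := by
    rw [reverse_natDegree, natTrailingDegree_eq_zero.2 (Or.inr hf), Nat.sub_zero]
  ext i
  rw [coeff_reverse, hd, coeff_reverse, revAt_invol]

/-- If `w.reverse * f` vanishes modulo `X ^ m - 1`, then the coefficient vectors of `f` and `w`
are orthogonal. -/
theorem sum_coeff_mul_coeff_eq_zero {F : Type} [Field F] {m : ℕ} {f w : F[X]}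
    (hf : f.natDegree < m) (hw : w.natDegree < m) (hdvd : (X ^ m - 1 : F[X]) ∣ f * w.reverse) :
    ∑ i : Fin m, f.coeff i * w.coeff i = 0 := by
  set d := w.natDegree with hd
  have key : (f * w.reverse).coeff d = ∑ i : Fin m, f.coeff i * w.coeff i := by
    rw [coeff_mul, Finset.Nat.sum_antidiagonal_eq_sum_range_succ
        (fun i j => f.coeff i * w.reverse.coeff j) d,
      Fin.sum_univ_eq_sum_range (fun i => f.coeff i * w.coeff i) m]
    rw [← Finset.sum_subset (Finset.range_mono (show d.succ ≤ m from hw))]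
    · refine Finset.sum_congr rfl fun i hi => ?_
      have hi' : i ≤ d := by simpa [Nat.lt_succ_iff] using hi
      rw [coeff_reverse, ← hd, revAt_le (Nat.sub_le d i), Nat.sub_sub_self hi']
    · intro i _ hi
      rw [coeff_eq_zero_of_natDegree_lt (p := w), mul_zero]
      simp at hi
      omega
  rw [← key]
  obtain ⟨u, hu⟩ := hdvd
  rw [hu, sub_mul, one_mul, coeff_sub, coeff_X_pow_mul', if_neg (by omega), zero_sub, neg_eq_zero]
  by_cases hu0 : u = 0
  · simp [hu0]
  apply coeff_eq_zero_of_natDegree_lt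
  have hdeg : (X ^ m - 1 : F[X]).natDegree = m := by
    simpa using natDegree_X_pow_sub_C (n := m) (r := (1 : F))
  have hne : (X ^ m - 1 : F[X]) ≠ 0 := by
    intro h
    rw [h, natDegree_zero] at hdeg
    omega
  have h1 := natDegree_mul hne hu0
  rw [← hu, hdeg] at h1
  have h2 := natDegree_mul_le (p := f) (q := w.reverse)
  have h3 := reverse_natDegree_le w
  omega

/-- Assume `g` and `l` are self-reciprocal.  If `r11` has positive degree, then the
quasi-cyclic code `C = ⟨(g11, g12), (0, g22)⟩` is not symplectic LCD. -/
theorem stmt12 (F : Type) [Field F] [Fintype F] [DecidableEq F] (m : ℕ) (hm : 0 < m)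
    (hqm : Nat.Coprime (Fintype.card F) m)
    (g11 g12 g22 : F[X])
    (h1 : g11 ∣ X ^ m - 1) (h2 : g22 ∣ X ^ m - 1)
    (h3 : g12.degree < g22.degree) (h4 : g11 * g22 ∣ (X ^ m - 1) * g12)
    (g l g11' g22' r11 t11 r22 t22 : F[X])
    (hg : g = gcd g11 g22) (hl : l = (X ^ m - 1) / lcm g11 g22)
    (h11' : g11' = g11 / g) (h22' : g22' = g22 / g)
    (hr11 : r11 = gcd g11' g11'.reverse) (ht11 : t11 = g11' / r11)
    (hr22 : r22 = gcd g22' g22'.reverse) (ht22 : t22 = g22' / r22)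
    (hsg : IsSelfReciprocal g) (hsl : IsSelfReciprocal l)
    (hdeg : 0 < r11.natDegree) :
    ¬ IsLCDWith
      (Submodule.span (AdjoinRoot (X ^ m - 1 : F[X]))
        {(AdjoinRoot.mk (X ^ m - 1 : F[X]) g11, AdjoinRoot.mk (X ^ m - 1 : F[X]) g12), (0, AdjoinRoot.mk (X ^ m - 1 : F[X]) g22)})
      (qcSympInner hm) := by
  have hmonic : (X ^ m - 1 : F[X]).Monic := by
    simpa using monic_X_pow_sub_C (1 : F) hm.ne'
  have hdegN : (X ^ m - 1 : F[X]).natDegree = m := by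
    simpa using natDegree_X_pow_sub_C (n := m) (r := (1 : F))
  have hm0 : (m : F) ≠ 0 := by
    have h := hqm.cast (R := F)
    rw [FiniteField.cast_card_eq_zero, isCoprime_zero_left] at h
    exact h.ne_zero
  have hsq : Squarefree (X ^ m - 1 : F[X]) := (X_pow_sub_one_separable_iff.2 hm0).squarefree
  have hg11 : g * g11' = g11 := by
    rw [h11', hg]
    exact EuclideanDomain.mul_div_cancel' (fun h => by
      have h0 : g11 = 0 := by simpa [h] using gcd_dvd_left g11 g22
      rw [h0, zero_dvd_iff] at h1
      exact hmonic.ne_zero h1) (gcd_dvd_left _ _)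
  have hr : r11 ∣ g11' := hr11 ▸ gcd_dvd_left _ _
  have hr' : r11 ∣ g11'.reverse := hr11 ▸ gcd_dvd_right _ _
  have hg11'd : g11' ∣ g11 := ⟨g, by rw [mul_comm, hg11]⟩
  obtain ⟨w, hw⟩ : r11 ∣ X ^ m - 1 := (hr.trans hg11'd).trans h1
  have hr0 : r11 ≠ 0 := by rintro rfl; simp at hdeg
  have hw0 : w ≠ 0 := by
    rintro rfl
    rw [mul_zero] at hw
    exact hmonic.ne_zero hw
  have hwdeg : w.natDegree < m := by
    have := natDegree_mul hr0 hw0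
    rw [← hw, hdegN] at this
    omega
  have hcop : IsCoprime r11 g22 := by
    refine isCoprime_of_irreducible_dvd (fun h => hr0 h.1) fun p hp hpr hp2 => ?_
    have hpg : p ∣ g := hg ▸ dvd_gcd ((hpr.trans hr).trans hg11'd) hp2
    exact hp.not_isUnit (hsq p ((mul_dvd_mul hpg (hpr.trans hr)).trans (hg11 ▸ h1)))
  have hrev : r11.reverse ∣ g11 := by
    obtain ⟨k, hk⟩ := hr'
    have hc : g11'.coeff 0 ≠ 0 := by
      obtain ⟨s, hs⟩ := hg11'd.trans h1
      intro h0
      have := congrArg (fun p => coeff p 0) hs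
      simp [mul_coeff_zero, h0, hm.ne] at this
    have hrr : g11'.reverse.reverse = g11' := reverse_reverse_of_coeff_zero_ne_zero hc
    rw [hk, reverse_mul_of_domain] at hrr
    exact (Dvd.intro _ hrr).trans hg11'd
  have hmod : w %ₘ (X ^ m - 1) = w :=
    (modByMonic_eq_self_iff hmonic).2 (degree_lt_degree (by rw [hdegN]; exact hwdeg))
  intro hL
  have hzero := hL (0, AdjoinRoot.mk _ w) ?_ ?_
  · have h := (AdjoinRoot.mk_eq_zero.1 (Prod.ext_iff.1 hzero).2)
    have := natDegree_le_of_dvd h hw0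
    omega
  · obtain ⟨a, b, hab⟩ := hcop
    refine Submodule.mem_span_pair.2 ⟨0, AdjoinRoot.mk _ (b * w), ?_⟩
    ext
    · simp
    · simp only [zero_smul, zero_add, Prod.smul_mk, smul_eq_mul, ← map_mul]
      rw [AdjoinRoot.mk_eq_mk]
      refine ⟨-a, ?_⟩
      linear_combination w * hab + a * hw
  · intro c hc
    obtain ⟨a, b, rfl⟩ := Submodule.mem_span_pair.1 hc
    obtain ⟨a, rfl⟩ := AdjoinRoot.mk_surjective a
    simp only [qcSympInner, qcToVec, Prod.smul_mk, Prod.mk_add_mk, smul_eq_mul, mul_zero, add_zero,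
      ← map_mul, AdjoinRoot.modByMonicHom_mk, map_zero, coeff_zero, Finset.sum_const_zero,
      sub_zero, hmod]
    refine sum_coeff_mul_coeff_eq_zero ?_ hwdeg ?_
    · have := natDegree_modByMonic_lt (a * g11) hmonic (fun h => by
        rw [h, natDegree_one] at hdegN
        omega)
      rwa [hdegN] at this
    · have hN : (X ^ m - 1 : F[X]) ∣ g11 * w.reverse := by
        have h := congrArg reverse hw
        rw [reverse_X_pow_sub_one m, reverse_mul_of_domain] at h
        obtain ⟨k, hk⟩ := hrev
        exact ⟨-k, by rw [hk]; linear_combination -k * h⟩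
      rw [modByMonic_eq_sub_mul_div, sub_mul]
      refine dvd_sub ?_ ?_
      · rw [mul_assoc]
        exact hN.mul_left a
      · rw [mul_assoc]
        exact dvd_mul_right _ _
end
end
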